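/- arXiv:2504.17863 — 5 statements merged into one kernel-verified Lean document; each statement's English description precedes it below -/
import Mathlib

section
/- Let M > 0, ℓ > 0 and let m_B(r) = M r³/(r² + ℓ²)^{3/2} be the Bardeen mass function. Then the Kretschmann scalar expression K(r) = 48 m_B(r)²/r⁶ − 64 m_B′(r) m_B(r)/r⁵ + 32 m_B′(r)²/r⁴ + 16 m_B″(r) m_B(r)/r⁴ − 16 m_B″(r) m_B′(r)/r³ + 4 m_B″(r)²/r² tends to 96 M²/ℓ⁶ as r → 0⁺. -/
lemma hasDerivAt_sqrt_sq_add_sq {ℓ : ℝ} (hℓ : 0 < ℓ) (r : ℝ) :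
    HasDerivAt (fun x : ℝ => Real.sqrt (x ^ 2 + ℓ ^ 2)) (r / Real.sqrt (r ^ 2 + ℓ ^ 2)) r := by
  have hpos : 0 < r ^ 2 + ℓ ^ 2 := by positivity
  have h := (((hasDerivAt_id r).pow 2).add_const (ℓ ^ 2)).sqrt hpos.ne'
  refine h.congr_deriv ?_
  simp only [id_eq, Pi.pow_apply]
  have := (Real.sqrt_pos.2 hpos).ne'
  field_simp
  norm_num

/-- The derivative of the Bardeen mass function. -/
lemma hasDerivAt_bardeenMass (M : ℝ) {ℓ : ℝ} (hℓ : 0 < ℓ) (r : ℝ) :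
    HasDerivAt (fun x : ℝ => M * x ^ 3 / Real.sqrt (x ^ 2 + ℓ ^ 2) ^ 3)
      (3 * M * ℓ ^ 2 * r ^ 2 / Real.sqrt (r ^ 2 + ℓ ^ 2) ^ 5) r := by
  have hpos : 0 < r ^ 2 + ℓ ^ 2 := by positivity
  have hS := Real.sqrt_pos.2 hpos
  have hsq := Real.sq_sqrt hpos.le
  have h := ((hasDerivAt_pow 3 r).const_mul M).fun_div
    ((hasDerivAt_sqrt_sq_add_sq hℓ r).fun_pow 3) (pow_pos hS 3).ne'
  refine h.congr_deriv ?_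
  set S := Real.sqrt (r ^ 2 + ℓ ^ 2)
  have hl : ℓ ^ 2 = S ^ 2 - r ^ 2 := by linarith
  rw [hl]
  push_cast
  field_simp

/-- The second derivative of the Bardeen mass function. -/
lemma hasDerivAt_deriv_bardeenMass (M : ℝ) {ℓ : ℝ} (hℓ : 0 < ℓ) (r : ℝ) :
    HasDerivAt (fun x : ℝ => 3 * M * ℓ ^ 2 * x ^ 2 / Real.sqrt (x ^ 2 + ℓ ^ 2) ^ 5)
      (3 * M * ℓ ^ 2 * r * (2 * ℓ ^ 2 - 3 * r ^ 2) / Real.sqrt (r ^ 2 + ℓ ^ 2) ^ 7) r := by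
  have hpos : 0 < r ^ 2 + ℓ ^ 2 := by positivity
  have hS := Real.sqrt_pos.2 hpos
  have hsq := Real.sq_sqrt hpos.le
  have h := ((hasDerivAt_pow 2 r).const_mul (3 * M * ℓ ^ 2)).fun_div
    ((hasDerivAt_sqrt_sq_add_sq hℓ r).fun_pow 5) (pow_pos hS 5).ne'
  refine h.congr_deriv ?_
  set S := Real.sqrt (r ^ 2 + ℓ ^ 2)
  have hl : ℓ ^ 2 = S ^ 2 - r ^ 2 := by linarith
  rw [hl]
  push_cast
  field_simp
  ring

/-- For the Bardeen mass function `m_B(r) = M r³/(r²+ℓ²)^{3/2}`, the Kretschmann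
scalar expression tends to `96 M²/ℓ⁶` as `r → 0⁺`. -/
theorem bardeen_kretschmann_limit (M ℓ : ℝ) (hM : 0 < M) (hℓ : 0 < ℓ) :
    let m : ℝ → ℝ := fun r => M * r^3 / Real.sqrt (r^2 + ℓ^2) ^ 3
    let K : ℝ → ℝ := fun r =>
      48 * (m r)^2 / r^6 - 64 * deriv m r * m r / r^5 + 32 * (deriv m r)^2 / r^4
        + 16 * deriv (deriv m) r * m r / r^4 - 16 * deriv (deriv m) r * deriv m r / r^3
        + 4 * (deriv (deriv m) r)^2 / r^2
    Filter.Tendsto K (nhdsWithin 0 (Set.Ioi 0)) (nhds (96 * M^2 / ℓ^6)) := by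
  intro m K
  have hm' : deriv m = fun r => 3 * M * ℓ ^ 2 * r ^ 2 / Real.sqrt (r ^ 2 + ℓ ^ 2) ^ 5 :=
    funext fun r => (hasDerivAt_bardeenMass M hℓ r).deriv
  have hm'' : deriv (deriv m) = fun r =>
      3 * M * ℓ ^ 2 * r * (2 * ℓ ^ 2 - 3 * r ^ 2) / Real.sqrt (r ^ 2 + ℓ ^ 2) ^ 7 := by
    rw [hm']
    exact funext fun r => (hasDerivAt_deriv_bardeenMass M hℓ r).deriv
  have hS (r : ℝ) : Real.sqrt (r ^ 2 + ℓ ^ 2) ≠ 0 := by positivity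
  let a : ℝ → ℝ := fun r => M / Real.sqrt (r ^ 2 + ℓ ^ 2) ^ 3
  let b : ℝ → ℝ := fun r => 3 * M * ℓ ^ 2 / Real.sqrt (r ^ 2 + ℓ ^ 2) ^ 5
  let c : ℝ → ℝ := fun r =>
    3 * M * ℓ ^ 2 * (2 * ℓ ^ 2 - 3 * r ^ 2) / Real.sqrt (r ^ 2 + ℓ ^ 2) ^ 7
  let G : ℝ → ℝ := fun r => 48 * a r ^ 2 - 64 * b r * a r + 32 * b r ^ 2
    + 16 * c r * a r - 16 * c r * b r + 4 * c r ^ 2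
  have ha : Continuous a := by fun_prop (disch := exact fun r => pow_ne_zero _ (hS r))
  have hb : Continuous b := by fun_prop (disch := exact fun r => pow_ne_zero _ (hS r))
  have hc : Continuous c := by fun_prop (disch := exact fun r => pow_ne_zero _ (hS r))
  have hG : Continuous G := by fun_prop
  have hG0 : G 0 = 96 * M ^ 2 / ℓ ^ 6 := by
    have h0 : Real.sqrt (0 ^ 2 + ℓ ^ 2) = ℓ := by
      rw [zero_pow two_ne_zero, zero_add, Real.sqrt_sq hℓ.le]
    simp only [G, a, b, c, h0]
    field_simp
    ring
  have hlim : Filter.Tendsto G (nhdsWithin 0 (Set.Ioi 0)) (nhds (96 * M ^ 2 / ℓ ^ 6)) :=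
    hG0 ▸ hG.continuousAt.tendsto.mono_left nhdsWithin_le_nhds
  refine hlim.congr' ?_
  filter_upwards [self_mem_nhdsWithin] with r hr
  have hr0 : r ≠ 0 := (Set.mem_Ioi.1 hr).ne'
  have hma : m r = r ^ 3 * a r := by simp only [m, a]; ring
  have hmb : deriv m r = r ^ 2 * b r := by rw [hm']; simp only [b]; ring
  have hmc : deriv (deriv m) r = r * c r := by rw [hm'']; simp only [c]; ring
  simp only [K, G, hma, hmb, hmc]
  field_simp
end

section
/- Let M > 0 and 0 < ℓ < 4M/(3√3), and set f_B(r) = 1 − 2M r²/(r² + ℓ²)^{3/2} for r > 0. Then f_B(r) → 1 as r → 0⁺, f_B(r) → 1 as r → ∞, and f_B(√2 ℓ) < 0; consequently f_B has at least two zeros in (0, ∞) (an inner and an outer horizon). -/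
/-- For the Bardeen metric function `f_B(r) = 1 − 2M r²/(r²+ℓ²)^{3/2}` with
`0 < ℓ < 4M/(3√3)`: `f_B → 1` as `r → 0⁺`, `f_B → 1` as `r → ∞`, `f_B(√2 ℓ) < 0`,
and consequently `f_B` has at least two zeros in `(0, ∞)`. -/
theorem bardeen_two_horizons (M ℓ : ℝ) (hM : 0 < M) (hℓ : 0 < ℓ)
    (hsmall : ℓ < 4 * M / (3 * Real.sqrt 3)) :
    let f : ℝ → ℝ := fun r => 1 - 2 * M * r^2 / Real.sqrt (r^2 + ℓ^2) ^ 3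
    Filter.Tendsto f (nhdsWithin 0 (Set.Ioi 0)) (nhds 1) ∧
    Filter.Tendsto f Filter.atTop (nhds 1) ∧
    f (Real.sqrt 2 * ℓ) < 0 ∧
    ∃ r₁ r₂ : ℝ, 0 < r₁ ∧ 0 < r₂ ∧ r₁ ≠ r₂ ∧ f r₁ = 0 ∧ f r₂ = 0 := by
  intro f
  have hden : ∀ r : ℝ, 0 < Real.sqrt (r ^ 2 + ℓ ^ 2) ^ 3 := fun r => by positivity
  have hcont : Continuous f := by
    have hne : ∀ r : ℝ, Real.sqrt (r ^ 2 + ℓ ^ 2) ^ 3 ≠ 0 := fun r => (hden r).ne'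
    fun_prop (disch := exact hne _)
  have hzero : Filter.Tendsto f (nhdsWithin 0 (Set.Ioi 0)) (nhds 1) := by
    have h := hcont.tendsto 0
    have hf0 : f 0 = 1 := by simp [f]
    rw [hf0] at h
    exact h.mono_left nhdsWithin_le_nhds
  have htop : Filter.Tendsto f Filter.atTop (nhds 1) := by
    have hlower : Filter.Tendsto (fun r : ℝ => 1 - 2 * M / r) Filter.atTop (nhds 1) := by
      simpa using (Filter.tendsto_id.const_div_atTop (2 * M)).const_sub (1 : ℝ)
    refine tendsto_of_tendsto_of_tendsto_of_le_of_le' hlower tendsto_const_nhds ?_ ?_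
    · filter_upwards [Filter.eventually_gt_atTop 0] with r hr
      have hsqrt : r ≤ Real.sqrt (r ^ 2 + ℓ ^ 2) :=
        Real.le_sqrt_of_sq_le (le_add_of_nonneg_right (sq_nonneg ℓ))
      have hbound : 2 * M * r ^ 2 / Real.sqrt (r ^ 2 + ℓ ^ 2) ^ 3 ≤ 2 * M / r := calc
        _ ≤ 2 * M * r ^ 2 / r ^ 3 := by gcongr
        _ = 2 * M / r := by field_simp
      exact sub_le_sub_left hbound 1
    · exact Filter.Eventually.of_forall fun r => sub_le_self 1 (by positivity)
  have hneg : f (Real.sqrt 2 * ℓ) < 0 := by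
    have h2 : (Real.sqrt 2 * ℓ) ^ 2 = 2 * ℓ ^ 2 := by
      rw [mul_pow, Real.sq_sqrt zero_le_two]
    have hsqrt : Real.sqrt (2 * ℓ ^ 2 + ℓ ^ 2) = Real.sqrt 3 * ℓ := by
      rw [show 2 * ℓ ^ 2 + ℓ ^ 2 = 3 * ℓ ^ 2 by ring, Real.sqrt_mul zero_le_three,
        Real.sqrt_sq hℓ.le]
    have hcube : Real.sqrt 3 ^ 3 = 3 * Real.sqrt 3 := by
      rw [pow_succ, Real.sq_sqrt zero_le_three]
    have hlt : ℓ * (3 * Real.sqrt 3) < 4 * M := (lt_div_iff₀ (by positivity)).mp hsmall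
    change 1 - 2 * M * (Real.sqrt 2 * ℓ) ^ 2 /
      Real.sqrt ((Real.sqrt 2 * ℓ) ^ 2 + ℓ ^ 2) ^ 3 < 0
    rw [h2, hsqrt, mul_pow, hcube, sub_neg, one_lt_div (by positivity)]
    calc 3 * Real.sqrt 3 * ℓ ^ 3 = ℓ * (3 * Real.sqrt 3) * ℓ ^ 2 := by ring
      _ < 4 * M * ℓ ^ 2 := by gcongr
      _ = 2 * M * (2 * ℓ ^ 2) := by ring
  refine ⟨hzero, htop, hneg, ?_⟩
  have hpos : 0 < Real.sqrt 2 * ℓ := by positivity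
  obtain ⟨a, hfa, ha, ham⟩ :=
    ((hzero.eventually_const_lt one_pos).and (Ioo_mem_nhdsGT hpos)).exists
  obtain ⟨b, hfb, hmb⟩ :=
    ((htop.eventually_const_lt one_pos).and (Filter.eventually_gt_atTop _)).exists
  obtain ⟨r₁, hr₁, hfr₁⟩ := intermediate_value_Ioo' ham.le hcont.continuousOn ⟨hneg, hfa⟩
  obtain ⟨r₂, hr₂, hfr₂⟩ := intermediate_value_Ioo hmb.le hcont.continuousOn ⟨hneg, hfb⟩
  exact ⟨r₁, r₂, ha.trans hr₁.1, hpos.trans hr₂.1, (hr₁.2.trans hr₂.1).ne, hfr₁, hfr₂⟩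
end

section
/- Let M > 0, C₀ > 0 and let m_Int(r) = (2M/π) arctan(C₀ r/M). Then r⁴ · K(r) tends to 64 C₀²/π² as r → 0⁺, where K(r) = 48 m_Int(r)²/r⁶ − 64 m_Int′(r) m_Int(r)/r⁵ + 32 m_Int′(r)²/r⁴ + 16 m_Int″(r) m_Int(r)/r⁴ − 16 m_Int″(r) m_Int′(r)/r³ + 4 m_Int″(r)²/r². In particular K(r) → +∞ as r → 0⁺, so r = 0 is a curvature singularity. -/
open Filter Topology in
/-- For a `C²` mass function vanishing at the origin, `r⁴ K(r) → 16 m′(0)²` as `r → 0⁺`. -/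
theorem tendsto_pow_four_mul_kretschmann {m : ℝ → ℝ} (hm : ContDiff ℝ 2 m) (h0 : m 0 = 0) :
    Tendsto (fun r => r^4 * (48 * (m r)^2 / r^6 - 64 * deriv m r * m r / r^5
        + 32 * (deriv m r)^2 / r^4 + 16 * deriv (deriv m) r * m r / r^4
        - 16 * deriv (deriv m) r * deriv m r / r^3 + 4 * (deriv (deriv m) r)^2 / r^2))
      (𝓝[>] 0) (𝓝 (16 * (deriv m 0)^2)) := by
  have hm' : ContDiff ℝ 1 (deriv m) := hm.deriv'
  have t0 : Tendsto (fun r : ℝ => r) (𝓝[>] 0) (𝓝 0) := tendsto_nhdsWithin_of_tendsto_nhds tendsto_id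
  have t1 : Tendsto (deriv m) (𝓝[>] 0) (𝓝 (deriv m 0)) := (hm'.continuous.tendsto 0).comp t0
  have t2 : Tendsto (deriv (deriv m)) (𝓝[>] 0) (𝓝 (deriv (deriv m) 0)) :=
    ((hm'.continuous_deriv le_rfl).tendsto 0).comp t0
  have t3 : Tendsto (fun r => m r / r) (𝓝[>] 0) (𝓝 (deriv m 0)) := by
    have h := (hm.differentiable (by norm_num) 0).hasDerivAt.tendsto_slope_zero_right
    simpa [h0, div_eq_inv_mul] using h
  have t4 := t2.mul t0
  have key := (((((t3.pow 2).const_mul 48).sub ((t1.mul t3).const_mul 64)).add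
    ((t1.pow 2).const_mul 32)).add ((t4.mul t3).const_mul 16)).sub
    ((t4.mul t1).const_mul 16) |>.add ((t4.pow 2).const_mul 4)
  convert key.congr' ?_ using 2
  · ring
  · filter_upwards [self_mem_nhdsWithin] with r hr
    have hr' : r ≠ 0 := ne_of_gt hr
    field_simp

/-- For the integrable-singularity mass function `m_Int(r) = (2M/π) arctan(C₀ r/M)`,
`r⁴ K(r) → 64 C₀²/π²` as `r → 0⁺`, and in particular `K(r) → +∞` as `r → 0⁺`. -/
theorem integrable_kretschmann_limit (M C₀ : ℝ) (hM : 0 < M) (hC : 0 < C₀) :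
    let m : ℝ → ℝ := fun r => (2 * M / Real.pi) * Real.arctan (C₀ * r / M)
    let K : ℝ → ℝ := fun r =>
      48 * (m r)^2 / r^6 - 64 * deriv m r * m r / r^5 + 32 * (deriv m r)^2 / r^4
        + 16 * deriv (deriv m) r * m r / r^4 - 16 * deriv (deriv m) r * deriv m r / r^3
        + 4 * (deriv (deriv m) r)^2 / r^2
    Filter.Tendsto (fun r => r^4 * K r) (nhdsWithin 0 (Set.Ioi 0))
        (nhds (64 * C₀^2 / Real.pi^2)) ∧
    Filter.Tendsto K (nhdsWithin 0 (Set.Ioi 0)) Filter.atTop := by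
  intro m K
  have hm : ContDiff ℝ 2 m :=
    contDiff_const.mul (((contDiff_const.mul contDiff_id).div_const M).arctan)
  have hd : deriv m 0 = 2 * C₀ / Real.pi := by
    have h : HasDerivAt m (2 * M / Real.pi * (1 / (1 + (C₀ * 0 / M)^2) * (C₀ * 1 / M))) 0 :=
      ((((hasDerivAt_id (0 : ℝ)).const_mul C₀).div_const M).arctan).const_mul _
    rw [h.deriv]
    field_simp
    simp
  have hlim : Filter.Tendsto (fun r => r^4 * K r) (nhdsWithin 0 (Set.Ioi 0))
      (nhds (64 * C₀^2 / Real.pi^2)) := by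
    convert tendsto_pow_four_mul_kretschmann hm (by simp [m]) using 2
    rw [hd]
    ring
  refine ⟨hlim, ?_⟩
  have hinv : Filter.Tendsto (fun r : ℝ => (r⁻¹)^4) (nhdsWithin 0 (Set.Ioi 0)) Filter.atTop :=
    (Filter.tendsto_pow_atTop (by norm_num)).comp tendsto_inv_nhdsGT_zero
  refine (hlim.pos_mul_atTop (by positivity) hinv).congr' ?_
  filter_upwards [self_mem_nhdsWithin] with r hr
  have hr' : r ≠ 0 := ne_of_gt hr
  field_simp
end

section
/- Let M > 0, C₀ > 0, m_Int(r) = (2M/π) arctan(C₀ r/M), and let K(r) be the Kretschmann scalar expression K(r) = 48 m_Int(r)²/r⁶ − 64 m_Int′(r) m_Int(r)/r⁵ + 32 m_Int′(r)²/r⁴ + 16 m_Int″(r) m_Int(r)/r⁴ − 16 m_Int″(r) m_Int′(r)/r³ + 4 m_Int″(r)²/r². Then for every a > 0 the function r ↦ √(K(r)) · r² is integrable on (0, a]; i.e., ∫₀^a √(K(r)) r² dr < ∞, even though K itself diverges at r = 0. -/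
open Filter Topology Set

/-- The Kretschmann scalar of the metric with mass function `m`. -/
noncomputable def kretschmann (m : ℝ → ℝ) (r : ℝ) : ℝ :=
  48 * (m r)^2 / r^6 - 64 * deriv m r * m r / r^5 + 32 * (deriv m r)^2 / r^4
    + 16 * deriv (deriv m) r * m r / r^4 - 16 * deriv (deriv m) r * deriv m r / r^3
    + 4 * (deriv (deriv m) r)^2 / r^2

/-- The function `r ^ 4 * kretschmann m r`, extended to `r = 0` when `m 0 = 0`. -/
noncomputable def rescaledKretschmann (m : ℝ → ℝ) (r : ℝ) : ℝ :=
  48 * (dslope m 0 r)^2 - 64 * deriv m r * dslope m 0 r + 32 * (deriv m r)^2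
    + 16 * (r * deriv (deriv m) r) * dslope m 0 r - 16 * (r * deriv (deriv m) r) * deriv m r
    + 4 * (r * deriv (deriv m) r)^2

lemma kretschmann_eq_div {m : ℝ → ℝ} (h0 : m 0 = 0) {r : ℝ} (hr : r ≠ 0) :
    kretschmann m r = rescaledKretschmann m r / r ^ 4 := by
  simp only [kretschmann, rescaledKretschmann, dslope_of_ne m hr, slope_def_field, h0, sub_zero]
  field_simp

lemma rescaledKretschmann_zero (m : ℝ → ℝ) :
    rescaledKretschmann m 0 = 16 * (deriv m 0) ^ 2 := by
  simp only [rescaledKretschmann, dslope_same]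
  ring

lemma continuous_rescaledKretschmann {m : ℝ → ℝ} (hm : ContDiff ℝ 2 m) :
    Continuous (rescaledKretschmann m) := by
  have hd : Differentiable ℝ m := hm.differentiable (by norm_num)
  have h₁ : ContDiff ℝ 1 (deriv m) := (contDiff_succ_iff_deriv (n := 1)).1 hm |>.2.2
  have h₂ : Continuous (deriv (deriv m)) := h₁.continuous_deriv le_rfl
  have h₃ : Continuous (deriv m) := h₁.continuous
  have h₄ : Continuous (dslope m 0) := by
    rw [← continuousOn_univ, continuousOn_dslope univ_mem]
    exact ⟨hd.continuous.continuousOn, hd 0⟩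
  unfold rescaledKretschmann
  fun_prop

/-- A `C²` mass function vanishing at the origin gives an integrable singularity. -/
lemma integrableOn_sqrt_kretschmann {m : ℝ → ℝ} (hm : ContDiff ℝ 2 m) (h0 : m 0 = 0) (a : ℝ) :
    MeasureTheory.IntegrableOn (fun r => √(kretschmann m r) * r ^ 2) (Ioc 0 a) := by
  refine ((continuous_rescaledKretschmann hm).sqrt.integrableOn_Ioc).congr_fun
    (fun r hr => ?_) measurableSet_Ioc
  have hr0 : r ≠ 0 := hr.1.ne'
  have hsq : √(r ^ 4) = r ^ 2 := by
    rw [show r ^ 4 = (r ^ 2) ^ 2 by ring, Real.sqrt_sq (sq_nonneg r)]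
  simp only [kretschmann_eq_div h0 hr0]
  rw [Real.sqrt_div' _ (by positivity), hsq]
  field_simp

lemma tendsto_kretschmann_atTop {m : ℝ → ℝ} (hm : ContDiff ℝ 2 m) (h0 : m 0 = 0)
    (h1 : deriv m 0 ≠ 0) : Tendsto (kretschmann m) (𝓝[>] 0) atTop := by
  have hQ : Tendsto (rescaledKretschmann m) (𝓝[>] 0) (𝓝 (16 * (deriv m 0) ^ 2)) := by
    rw [← rescaledKretschmann_zero]
    exact (continuous_rescaledKretschmann hm).continuousAt.tendsto.mono_left nhdsWithin_le_nhds
  have hI : Tendsto (fun r : ℝ => (r⁻¹) ^ 4) (𝓝[>] 0) atTop :=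
    (tendsto_pow_atTop (by norm_num)).comp tendsto_inv_nhdsGT_zero
  refine (hQ.pos_mul_atTop (by positivity) hI).congr' ?_
  filter_upwards [self_mem_nhdsWithin] with r hr
  rw [kretschmann_eq_div h0 (ne_of_gt hr), inv_pow, div_eq_mul_inv]

/-- For the integrable-singularity mass function `m_Int(r) = (2M/π) arctan(C₀ r/M)`,
the function `√(K(r)) r²` is integrable on `(0, a]` for every `a > 0`, even though
`K` itself diverges at `r = 0`. -/
theorem integrable_singularity_sqrtK_integrable (M C₀ : ℝ) (hM : 0 < M) (hC : 0 < C₀) :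
    let m : ℝ → ℝ := fun r => (2 * M / Real.pi) * Real.arctan (C₀ * r / M)
    let K : ℝ → ℝ := fun r =>
      48 * (m r)^2 / r^6 - 64 * deriv m r * m r / r^5 + 32 * (deriv m r)^2 / r^4
        + 16 * deriv (deriv m) r * m r / r^4 - 16 * deriv (deriv m) r * deriv m r / r^3
        + 4 * (deriv (deriv m) r)^2 / r^2
    (∀ a : ℝ, 0 < a →
      MeasureTheory.IntegrableOn (fun r => Real.sqrt (K r) * r^2) (Set.Ioc 0 a)) ∧
    Filter.Tendsto K (nhdsWithin 0 (Set.Ioi 0)) Filter.atTop := by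
  intro m K
  have hm : ContDiff ℝ 2 m :=
    contDiff_const.mul (Real.contDiff_arctan.comp ((contDiff_const.mul contDiff_id).div_const M))
  have h0 : m 0 = 0 := by simp [m]
  have hlin : HasDerivAt (fun r : ℝ => C₀ * r / M) (C₀ * 1 / M) 0 :=
    ((hasDerivAt_id (0 : ℝ)).const_mul C₀).div_const M
  have h1 : deriv m 0 ≠ 0 := by
    rw [(hlin.arctan.const_mul (2 * M / Real.pi)).deriv]
    have := Real.pi_pos
    positivity
  exact ⟨fun a _ => integrableOn_sqrt_kretschmann hm h0 a, tendsto_kretschmann_atTop hm h0 h1⟩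
end

section
/- Let M > 0 and C₀ > π/4, and set f(r) = 1 − (4M/(π r)) arctan(C₀ r/M) for r > 0. Then: (i) f(r) → 1 − 4C₀/π < 0 as r → 0⁺ (the metric component stays finite and negative at the center); (ii) f is strictly increasing on (0, ∞); (iii) f(r) → 1 as r → ∞; hence (iv) f has exactly one zero r_h ∈ (0, ∞), i.e., the spacetime has a single horizon and no inner horizon. -/
open Filter Topology in
lemma tendsto_arctan_div_self_nhdsGT_zero :
    Tendsto (fun x : ℝ => Real.arctan x / x) (𝓝[>] 0) (𝓝 1) := by
  have h := (Real.hasDerivAt_arctan 0).tendsto_slope_zero_right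
  simpa [div_eq_inv_mul] using h

open Filter Topology in
lemma tendsto_arctan_div_self_atTop :
    Tendsto (fun x : ℝ => Real.arctan x / x) atTop (𝓝 0) :=
  (Real.tendsto_arctan_atTop.mono_right nhdsWithin_le_nhds).div_atTop tendsto_id

lemma strictConcaveOn_arctan : StrictConcaveOn ℝ (Set.Ici 0) Real.arctan := by
  refine StrictAntiOn.strictConcaveOn_of_deriv (convex_Ici 0)
    Real.continuous_arctan.continuousOn ?_
  rw [interior_Ici, Real.deriv_arctan]
  intro x (hx : 0 < x) y _ hxy
  dsimp only
  gcongr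

lemma strictAntiOn_arctan_div_self :
    StrictAntiOn (fun x : ℝ => Real.arctan x / x) (Set.Ioi 0) := by
  intro x (hx : 0 < x) y (hy : 0 < y) hxy
  simpa using strictConcaveOn_arctan.secant_strict_mono (a := 0) (x := x) (y := y)
    Set.self_mem_Ici hx.le hy.le hx.ne' hy.ne' hxy

/-- For the integrable-singularity metric function
`f(r) = 1 − (4M/(π r)) arctan(C₀ r/M)` with `M > 0` and `C₀ > π/4`:
(i) `f(r) → 1 − 4C₀/π < 0` as `r → 0⁺`; (ii) `f` is strictly increasing on `(0,∞)`;
(iii) `f(r) → 1` as `r → ∞`; hence (iv) `f` has exactly one zero in `(0,∞)`. -/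
theorem integrable_singularity_single_horizon (M C₀ : ℝ) (hM : 0 < M)
    (hC : Real.pi / 4 < C₀) :
    let f : ℝ → ℝ := fun r => 1 - (4 * M / (Real.pi * r)) * Real.arctan (C₀ * r / M)
    (Filter.Tendsto f (nhdsWithin 0 (Set.Ioi 0)) (nhds (1 - 4 * C₀ / Real.pi)) ∧
      1 - 4 * C₀ / Real.pi < 0) ∧
    StrictMonoOn f (Set.Ioi 0) ∧
    Filter.Tendsto f Filter.atTop (nhds 1) ∧
    (∃! r : ℝ, 0 < r ∧ f r = 0) := by
  intro f
  have hpi := Real.pi_pos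
  have hC₀ : 0 < C₀ := by linarith
  have hk : 0 < C₀ / M := by positivity
  have hf : f = fun r => 1 - 4 * C₀ / Real.pi * (Real.arctan (C₀ / M * r) / (C₀ / M * r)) := by
    funext r
    rcases eq_or_ne r 0 with rfl | hr
    · simp [f]
    · simp only [f, mul_div_right_comm C₀ r M]
      field_simp
  have hneg : 1 - 4 * C₀ / Real.pi < 0 := by
    rw [sub_neg, one_lt_div hpi]
    linarith
  have hzero : Filter.Tendsto f (nhdsWithin 0 (Set.Ioi 0)) (nhds (1 - 4 * C₀ / Real.pi)) := by
    have hscale : Filter.Tendsto (fun r => C₀ / M * r) (nhdsWithin 0 (Set.Ioi 0))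
        (nhdsWithin 0 (Set.Ioi 0)) := by
      refine tendsto_nhdsWithin_iff.2 ⟨?_, ?_⟩
      · have : Filter.Tendsto (fun r => C₀ / M * r) (nhds 0) (nhds (C₀ / M * 0)) :=
          (continuous_const_mul _).tendsto 0
        rw [mul_zero] at this
        exact this.mono_left nhdsWithin_le_nhds
      · filter_upwards [self_mem_nhdsWithin] with r hr using mul_pos hk hr
    simpa [hf] using ((tendsto_arctan_div_self_nhdsGT_zero.comp hscale).const_mul
      (4 * C₀ / Real.pi)).const_sub 1
  have htop : Filter.Tendsto f Filter.atTop (nhds 1) := by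
    simpa [hf] using ((tendsto_arctan_div_self_atTop.comp
      (Filter.tendsto_id.const_mul_atTop hk)).const_mul (4 * C₀ / Real.pi)).const_sub 1
  have hmono : StrictMonoOn f (Set.Ioi 0) := by
    intro x hx y hy hxy
    have h := strictAntiOn_arctan_div_self (Set.mem_Ioi.2 (mul_pos hk hx))
      (Set.mem_Ioi.2 (mul_pos hk hy)) (mul_lt_mul_of_pos_left hxy hk)
    simp only [hf]
    exact sub_lt_sub_left (mul_lt_mul_of_pos_left h (by positivity)) 1
  have hcont : ContinuousOn f (Set.Ioi 0) := by
    intro x hx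
    have hx' : Real.pi * x ≠ 0 := (mul_pos hpi hx).ne'
    exact ContinuousAt.continuousWithinAt (by fun_prop (disch := assumption))
  obtain ⟨a, ha, hfa⟩ :=
    (eventually_mem_nhdsWithin.and (hzero.eventually_lt_const hneg)).exists
  obtain ⟨b, hb, hfb⟩ :=
    ((Filter.eventually_gt_atTop 0).and (htop.eventually_const_lt one_pos)).exists
  obtain ⟨r, hr, hfr⟩ := isPreconnected_Ioi.intermediate_value ha hb hcont ⟨hfa.le, hfb.le⟩
  exact ⟨⟨hzero, hneg⟩, hmono, htop, r, ⟨hr, hfr⟩,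
    fun s hs => hmono.injOn hs.1 hr (hs.2.trans hfr.symm)⟩
end
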